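/- Let μ₁, μ₂ ≥ 0 and let (P₁, Q₁) be probability measures on a measurable space Ω₁ satisfying μ₁-Gaussian differential privacy and (P₂, Q₂) probability measures on a measurable space Ω₂ satisfying μ₂-Gaussian differential privacy. Then the product measures (P₁ × P₂, Q₁ × Q₂) on Ω₁ × Ω₂ satisfy μ-Gaussian differential privacy with μ = √(μ₁² + μ₂²): every rejection rule φ : Ω₁ × Ω₂ → [0,1] with type I error α = ∫ φ d(P₁ × P₂) ∈ (0,1) has type II error 1 − ∫ φ d(Q₁ × Q₂) ≥ Φ(Φ⁻¹(1 − α) − √(μ₁² + μ₂²)). -/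

import Mathlib

open MeasureTheory ProbabilityTheory Real

/-- The standard normal cumulative distribution function `Φ`. -/
noncomputable def Phi (x : ℝ) : ℝ := ((gaussianReal 0 1) (Set.Iic x)).toReal

/-- The inverse `Φ⁻¹` of the standard normal CDF (on `(0,1)`). -/
noncomputable def PhiInv : ℝ → ℝ := Function.invFun Phi

lemma Phi_eq_cdf (x : ℝ) : Phi x = cdf (gaussianReal 0 1) x := by
  rw [cdf_eq_real]; rfl

lemma measurable_Phi : Measurable Phi := by
  rw [funext Phi_eq_cdf]
  exact (monotone_cdf _).measurable

lemma continuous_Phi : Continuous Phi := by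
  rw [funext Phi_eq_cdf, continuous_iff_continuousAt]
  intro x
  have hs := (cdf (gaussianReal 0 1)).measure_singleton x
  have := nullSingletonClass_gaussianReal (μ := 0) (v := 1) one_ne_zero
  rw [measure_cdf, measure_singleton, eq_comm, ENNReal.ofReal_eq_zero, sub_nonpos] at hs
  rw [(monotone_cdf _).continuousAt_iff_leftLim_eq_rightLim, StieltjesFunction.rightLim_eq]
  exact le_antisymm ((monotone_cdf _).leftLim_le le_rfl) hs

lemma strictMono_Phi : StrictMono Phi := by
  intro x y hxy
  have hpos : gaussianReal 0 1 (Set.Ioc x y) ≠ 0 := by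
    intro h0
    have := gaussianReal_absolutelyContinuous' 0 (v := 1) one_ne_zero h0
    rw [Real.volume_Ioc, ENNReal.ofReal_eq_zero] at this
    linarith
  rw [Phi_eq_cdf, Phi_eq_cdf]
  rw [← measure_cdf (gaussianReal 0 1), StieltjesFunction.measure_Ioc, ne_eq,
    ENNReal.ofReal_eq_zero, not_le] at hpos
  linarith

lemma tendsto_Phi_atTop : Filter.Tendsto Phi Filter.atTop (nhds 1) := by
  rw [funext Phi_eq_cdf]
  exact tendsto_cdf_atTop _

lemma tendsto_Phi_atBot : Filter.Tendsto Phi Filter.atBot (nhds 0) := by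
  rw [funext Phi_eq_cdf]
  exact tendsto_cdf_atBot _

lemma Phi_pos (x : ℝ) : 0 < Phi x :=
  lt_of_le_of_lt (by rw [Phi_eq_cdf]; exact cdf_nonneg _ _) (strictMono_Phi (sub_one_lt x))

lemma Phi_lt_one (x : ℝ) : Phi x < 1 :=
  lt_of_lt_of_le (strictMono_Phi (lt_add_one x)) (by rw [Phi_eq_cdf]; exact cdf_le_one _ _)

lemma PhiInv_Phi (x : ℝ) : PhiInv (Phi x) = x :=
  Function.leftInverse_invFun strictMono_Phi.injective x

lemma Phi_PhiInv {a : ℝ} (ha : a ∈ Set.Ioo (0 : ℝ) 1) : Phi (PhiInv a) = a :=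
  Function.invFun_eq <| mem_range_of_exists_le_of_exists_ge continuous_Phi
    ((tendsto_Phi_atBot.eventually_le_const ha.1).exists)
    ((tendsto_Phi_atTop.eventually_const_le ha.2).exists)

lemma gaussianReal_real_Iic (m x : ℝ) : (gaussianReal m 1).real (Set.Iic x) = Phi (x - m) := by
  have h := gaussianReal_map_add_const (μ := 0) (v := 1) m
  rw [zero_add] at h
  rw [← h, map_measureReal_apply (by fun_prop) measurableSet_Iic, Phi, Measure.real]
  congr 2
  ext z
  simp [le_sub_iff_add_le]

lemma gaussianReal_real_Ioi (m x : ℝ) :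
    (gaussianReal m 1).real (Set.Ioi x) = 1 - Phi (x - m) := by
  rw [← Set.compl_Iic, probReal_compl_eq_one_sub measurableSet_Iic, gaussianReal_real_Iic]

/-- The power against `N(m, 1)` of the optimal test of size `a` for `N(0, 1)`. -/
lemma gaussianReal_real_one_sub_lt_Phi (m : ℝ) {a : ℝ} (ha : a ∈ Set.Ioo (0 : ℝ) 1) :
    (gaussianReal m 1).real {z | 1 - a < Phi z} = 1 - Phi (PhiInv (1 - a) - m) := by
  rw [← gaussianReal_real_Ioi]
  congr 1
  ext z
  have h : Phi (PhiInv (1 - a)) = 1 - a := Phi_PhiInv ⟨by linarith [ha.2], by linarith [ha.1]⟩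
  nth_rw 1 [Set.mem_ofPred_eq, ← h, strictMono_Phi.lt_iff_lt, Set.mem_Ioi]

lemma gaussianReal_real_one_sub_zero_lt_Phi (m : ℝ) :
    (gaussianReal m 1).real {z | 1 - 0 < Phi z} = 0 := by
  have : {z | 1 - 0 < Phi z} = ∅ := by
    ext z
    simpa using (Phi_lt_one z).le
  rw [this, measureReal_empty]

lemma gaussianReal_real_one_sub_one_lt_Phi (m : ℝ) :
    (gaussianReal m 1).real {z | 1 - 1 < Phi z} = 1 := by
  have : {z | 1 - 1 < Phi z} = Set.univ := by
    ext z
    simpa using Phi_pos z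
  rw [this, probReal_univ]

lemma gaussianReal_zero_real_one_sub_lt_Phi {a : ℝ} (ha : a ∈ Set.Icc (0 : ℝ) 1) :
    (gaussianReal 0 1).real {z | 1 - a < Phi z} = a := by
  rcases eq_or_lt_of_le ha.1 with rfl | h0
  · exact gaussianReal_real_one_sub_zero_lt_Phi 0
  rcases eq_or_lt_of_le ha.2 with rfl | h1
  · exact gaussianReal_real_one_sub_one_lt_Phi 0
  rw [gaussianReal_real_one_sub_lt_Phi 0 ⟨h0, h1⟩, sub_zero,
    Phi_PhiInv ⟨by linarith, by linarith⟩, sub_sub_cancel]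

/-- Gaussian differential privacy of the pair `(P, Q)` with parameter `m`. -/
def IsGDP {Ω : Type*} [MeasurableSpace Ω] (m : ℝ) (P Q : Measure Ω) : Prop :=
  ∀ ψ : Ω → ℝ, Measurable ψ → (∀ x, ψ x ∈ Set.Icc (0 : ℝ) 1) →
    (∫ x, ψ x ∂P) ∈ Set.Ioo (0 : ℝ) 1 →
    1 - ∫ x, ψ x ∂Q ≥ Phi (PhiInv (1 - ∫ x, ψ x ∂P) - m)

section

variable {Ω Z : Type*} [MeasurableSpace Ω] [MeasurableSpace Z]

lemma integrable_of_mem_Icc {ψ : Ω → ℝ} (hψ : Measurable ψ)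
    (h01 : ∀ x, ψ x ∈ Set.Icc (0 : ℝ) 1) (P : Measure Ω) [IsFiniteMeasure P] :
    Integrable ψ P :=
  Integrable.of_mem_Icc 0 1 hψ.aemeasurable (.of_forall h01)

lemma integral_mem_Icc {ψ : Ω → ℝ} (hψ : Measurable ψ)
    (h01 : ∀ x, ψ x ∈ Set.Icc (0 : ℝ) 1) (P : Measure Ω) [IsProbabilityMeasure P] :
    ∫ x, ψ x ∂P ∈ Set.Icc (0 : ℝ) 1 := by
  refine ⟨integral_nonneg fun x => (h01 x).1, ?_⟩
  simpa using integral_mono (integrable_of_mem_Icc hψ h01 P) (integrable_const (1 : ℝ))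
    fun x => (h01 x).2

lemma IsGDP.integral_nonpos {m : ℝ} {P Q : Measure Ω} [IsProbabilityMeasure P]
    [IsProbabilityMeasure Q] (h : IsGDP m P Q) {ψ : Ω → ℝ} (hψ : Measurable ψ)
    (h01 : ∀ x, ψ x ∈ Set.Icc (0 : ℝ) 1) (h0 : ∫ x, ψ x ∂P = 0) : ∫ x, ψ x ∂Q ≤ 0 := by
  have mix (ν : Measure Ω) [IsProbabilityMeasure ν] (t : ℝ) :
      ∫ x, ((1 - Phi t) + Phi t * ψ x) ∂ν = (1 - Phi t) + Phi t * ∫ x, ψ x ∂ν := by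
    rw [integral_add (integrable_const _) ((integrable_of_mem_Icc hψ h01 ν).const_mul _),
      integral_const_mul]
    simp
  have key (t : ℝ) : Phi (t - m) ≤ Phi t * (1 - ∫ x, ψ x ∂Q) := by
    have ht0 := Phi_pos t
    have ht1 := Phi_lt_one t
    have := h (fun x => (1 - Phi t) + Phi t * ψ x) (by fun_prop)
      (fun x => ⟨by nlinarith [(h01 x).1], by nlinarith [(h01 x).2]⟩)
      (by rw [mix, h0]; constructor <;> linarith)
    rw [mix, mix, h0, mul_zero, add_zero, sub_sub_cancel, PhiInv_Phi] at this
    linarith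
  have h1 : Filter.Tendsto (fun t => Phi (t - m)) Filter.atTop (nhds 1) :=
    tendsto_Phi_atTop.comp (Filter.tendsto_atTop_add_const_right _ (-m) Filter.tendsto_id)
  have := le_of_tendsto_of_tendsto' h1 (tendsto_Phi_atTop.mul_const _) key
  linarith

lemma IsGDP.integral_le {m : ℝ} {P Q : Measure Ω} [IsProbabilityMeasure P]
    [IsProbabilityMeasure Q] (h : IsGDP m P Q) {ψ : Ω → ℝ} (hψ : Measurable ψ)
    (h01 : ∀ x, ψ x ∈ Set.Icc (0 : ℝ) 1) :
    ∫ x, ψ x ∂Q ≤ (gaussianReal m 1).real {z | 1 - ∫ x, ψ x ∂P < Phi z} := by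
  have ha := integral_mem_Icc hψ h01 P
  rcases eq_or_lt_of_le ha.1 with h0 | h0
  · rw [← h0, gaussianReal_real_one_sub_zero_lt_Phi]
    exact h.integral_nonpos hψ h01 h0.symm
  rcases eq_or_lt_of_le ha.2 with h1 | h1
  · rw [h1, gaussianReal_real_one_sub_one_lt_Phi]
    exact (integral_mem_Icc hψ h01 Q).2
  rw [gaussianReal_real_one_sub_lt_Phi m ⟨h0, h1⟩]
  linarith [h ψ hψ h01 ⟨h0, h1⟩]

/-- A test on `Ω × Z` can be replaced by one on `ℝ × Z` of the same size that is at least as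
powerful when `(P, Q)` is replaced by `(N(0, 1), N(m, 1))`. -/
lemma IsGDP.exists_gaussian_test {m : ℝ} {P Q : Measure Ω} [IsProbabilityMeasure P]
    [IsProbabilityMeasure Q] (h : IsGDP m P Q) (R S : Measure Z) [IsProbabilityMeasure R]
    [IsProbabilityMeasure S] {φ : Ω × Z → ℝ} (hφ : Measurable φ)
    (h01 : ∀ x, φ x ∈ Set.Icc (0 : ℝ) 1) :
    ∃ χ : ℝ × Z → ℝ, Measurable χ ∧ (∀ x, χ x ∈ Set.Icc (0 : ℝ) 1) ∧
      ∫ x, χ x ∂((gaussianReal 0 1).prod R) = ∫ x, φ x ∂(P.prod R) ∧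
      ∫ x, φ x ∂(Q.prod S) ≤ ∫ x, χ x ∂((gaussianReal m 1).prod S) := by
  have hs (y : Z) : Measurable fun x => φ (x, y) := by fun_prop
  have ha : Measurable fun y => ∫ x, φ (x, y) ∂P :=
    (hφ.stronglyMeasurable.integral_prod_left').measurable
  set A : Set (ℝ × Z) := {p | 1 - ∫ x, φ (x, p.2) ∂P < Phi p.1}
  have hAm : MeasurableSet A :=
    measurableSet_lt (measurable_const.sub (ha.comp measurable_snd))
      (measurable_Phi.comp measurable_fst)
  have hχ : Measurable (A.indicator (1 : ℝ × Z → ℝ)) := measurable_one.indicator hAm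
  have hχ01 (x : ℝ × Z) : A.indicator (1 : ℝ × Z → ℝ) x ∈ Set.Icc (0 : ℝ) 1 := by
    by_cases hx : x ∈ A <;> simp [hx]
  have slice (k : ℝ) (y : Z) : ∫ z, A.indicator (1 : ℝ × Z → ℝ) (z, y) ∂(gaussianReal k 1) =
      (gaussianReal k 1).real {z | 1 - ∫ x, φ (x, y) ∂P < Phi z} :=
    integral_indicator_one (s := {z | 1 - ∫ x, φ (x, y) ∂P < Phi z})
      (measurableSet_lt measurable_const measurable_Phi)
  refine ⟨A.indicator 1, hχ, hχ01, ?_, ?_⟩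
  · rw [integral_prod_symm _ (integrable_of_mem_Icc hχ hχ01 _),
      integral_prod_symm _ (integrable_of_mem_Icc hφ h01 _)]
    refine integral_congr_ae (.of_forall fun y => ?_)
    simp only [slice]
    exact gaussianReal_zero_real_one_sub_lt_Phi (integral_mem_Icc (hs y) (fun x => h01 _) P)
  · have iχ := integrable_of_mem_Icc hχ hχ01 ((gaussianReal m 1).prod S)
    have iφ := integrable_of_mem_Icc hφ h01 (Q.prod S)
    rw [integral_prod_symm _ iχ, integral_prod_symm _ iφ]
    refine integral_mono iφ.integral_prod_right iχ.integral_prod_right fun y => ?_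
    simp only [slice]
    exact h.integral_le (hs y) fun x => h01 _

end

lemma gaussianReal_eq_withDensity (m : ℝ) :
    gaussianReal m 1 = (gaussianReal 0 1).withDensity
      fun x => ENNReal.ofReal (exp (m * x - m ^ 2 / 2)) := by
  rw [gaussianReal_of_var_ne_zero m one_ne_zero, gaussianReal_of_var_ne_zero 0 one_ne_zero,
    ← withDensity_mul _ (measurable_gaussianPDF 0 1) (by fun_prop)]
  congr 1
  ext x
  rw [Pi.mul_apply, gaussianPDF, gaussianPDF,
    ← ENNReal.ofReal_mul (gaussianPDFReal_nonneg _ _ _)]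
  simp only [gaussianPDFReal, mul_assoc, ← exp_add]
  congr 4
  simp
  ring

lemma gaussianReal_prod_eq_withDensity (m n : ℝ) :
    (gaussianReal m 1).prod (gaussianReal n 1) =
      ((gaussianReal 0 1).prod (gaussianReal 0 1)).withDensity
        fun p => ENNReal.ofReal (exp (m * p.1 + n * p.2 - (m ^ 2 + n ^ 2) / 2)) := by
  have : SFinite ((gaussianReal 0 1).withDensity
      fun x => ENNReal.ofReal (exp (n * x - n ^ 2 / 2))) := by
    rw [← gaussianReal_eq_withDensity]; infer_instance
  rw [gaussianReal_eq_withDensity m, gaussianReal_eq_withDensity n,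
    prod_withDensity (by fun_prop) (by fun_prop)]
  congr 1
  ext p
  rw [← ENNReal.ofReal_mul (exp_nonneg _), ← exp_add]
  congr 2
  ring

/-- The probability of a half-plane under a product of two normal laws of unit variance. -/
lemma gaussianReal_prod_real_halfPlane {m n s : ℝ} (hs : 0 < s) (hsq : s ^ 2 = m ^ 2 + n ^ 2)
    (a b t : ℝ) :
    ((gaussianReal a 1).prod (gaussianReal b 1)).real {p | s * t < m * p.1 + n * p.2} =
      1 - Phi (t - (m * a + n * b) / s) := by
  have h : (((gaussianReal a 1).prod (gaussianReal b 1)).map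
      fun p : ℝ × ℝ => m / s * p.1 + n / s * p.2) = gaussianReal ((m * a + n * b) / s) 1 := by
    have h1 : (fun p : ℝ × ℝ => m / s * p.1 + n / s * p.2) =
      (fun p : ℝ × ℝ => p.1 + p.2) ∘ Prod.map (m / s * ·) (n / s * ·) := rfl
    rw [h1, ← Measure.map_map (by fun_prop) (by fun_prop),
      ← Measure.map_prod_map _ _ (by fun_prop) (by fun_prop), gaussianReal_map_const_mul,
      gaussianReal_map_const_mul, ← Measure.conv, gaussianReal_conv_gaussianReal]
    congr 1
    · ring
    · ext
      simp [div_pow, ← add_div, ← hsq, hs.ne']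
  rw [← gaussianReal_real_Ioi, ← h, map_measureReal_apply (by fun_prop) measurableSet_Ioi]
  congr 1
  ext p
  simp only [Set.mem_ofPred_eq, Set.mem_preimage, Set.mem_Ioi]
  rw [← lt_div_iff₀' hs]
  congr! 1
  ring

/-- The Neyman–Pearsonlemma for a shift of the mean of the standard normal law on the plane. -/
lemma gaussian_prod_test_le {m n : ℝ} {χ : ℝ × ℝ → ℝ} (hχ : Measurable χ)
    (h01 : ∀ x, χ x ∈ Set.Icc (0 : ℝ) 1)
    (hα : ∫ x, χ x ∂((gaussianReal 0 1).prod (gaussianReal 0 1)) ∈ Set.Ioo (0 : ℝ) 1) :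
    ∫ x, χ x ∂((gaussianReal m 1).prod (gaussianReal n 1)) ≤
      1 - Phi (PhiInv (1 - ∫ x, χ x ∂((gaussianReal 0 1).prod (gaussianReal 0 1))) -
        √(m ^ 2 + n ^ 2)) := by
  set α := ∫ x, χ x ∂((gaussianReal 0 1).prod (gaussianReal 0 1)) with hα_def
  have hinv : Phi (PhiInv (1 - α)) = 1 - α :=
    Phi_PhiInv ⟨by linarith [hα.2], by linarith [hα.1]⟩
  set t := PhiInv (1 - α)
  set s := √(m ^ 2 + n ^ 2)
  have hsq : s ^ 2 = m ^ 2 + n ^ 2 := sq_sqrt (by positivity)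
  rcases (sqrt_nonneg (m ^ 2 + n ^ 2)).eq_or_lt with hs | hs
  · change 0 = s at hs
    have hm : m = 0 := by nlinarith [sq_nonneg m, sq_nonneg n]
    have hn : n = 0 := by nlinarith [sq_nonneg m, sq_nonneg n]
    rw [hm, hn, ← hα_def, ← hs, sub_zero, hinv, sub_sub_cancel]
  change 0 < s at hs
  set A : Set (ℝ × ℝ) := {p | s * t < m * p.1 + n * p.2}
  have hAm : MeasurableSet A := measurableSet_lt measurable_const (by fun_prop)
  have hA0 : ((gaussianReal 0 1).prod (gaussianReal 0 1)).real A = α := by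
    rw [gaussianReal_prod_real_halfPlane hs hsq]
    simp [hinv]
  have hA1 : ((gaussianReal m 1).prod (gaussianReal n 1)).real A = 1 - Phi (t - s) := by
    rw [gaussianReal_prod_real_halfPlane hs hsq]
    congr 3
    rw [div_eq_iff hs.ne']
    linarith
  have hi (ν : Measure (ℝ × ℝ)) [IsFiniteMeasure ν] : Integrable (A.indicator (1 : ℝ × ℝ → ℝ)) ν :=
    (integrable_const (1 : ℝ)).indicator hAm
  have hg (ν : Measure (ℝ × ℝ)) [IsFiniteMeasure ν] :
      Integrable (fun x => χ x - A.indicator 1 x) ν :=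
    (integrable_of_mem_Icc hχ h01 ν).sub (hi ν)
  have hgi (ν : Measure (ℝ × ℝ)) [IsFiniteMeasure ν] :
      ∫ x, (χ x - A.indicator 1 x) ∂ν = ∫ x, χ x ∂ν - ν.real A := by
    rw [integral_sub (integrable_of_mem_Icc hχ h01 ν) (hi ν), integral_indicator_one hAm]
  rw [← hA1, ← sub_nonpos, ← hgi]
  have hgQ := hg ((gaussianReal m 1).prod (gaussianReal n 1))
  have hL : Measurable fun p : ℝ × ℝ =>
      ENNReal.ofReal (exp (m * p.1 + n * p.2 - (m ^ 2 + n ^ 2) / 2)) := by fun_prop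
  rw [gaussianReal_prod_eq_withDensity,
    integrable_withDensity_iff_integrable_smul' hL (.of_forall fun _ => ENNReal.ofReal_lt_top)]
    at hgQ
  rw [gaussianReal_prod_eq_withDensity,
    integral_withDensity_eq_integral_toReal_smul hL (.of_forall fun _ => ENNReal.ofReal_lt_top)]
  have h0 : ∫ x, exp (s * t - (m ^ 2 + n ^ 2) / 2) * (χ x - A.indicator 1 x)
      ∂((gaussianReal 0 1).prod (gaussianReal 0 1)) = 0 := by
    rw [integral_const_mul, hgi, hA0, ← hα_def, sub_self, mul_zero]
  refine le_trans ?_ h0.le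
  refine integral_mono hgQ ((hg _).const_mul _) fun p => ?_
  simp only [smul_eq_mul, ENNReal.toReal_ofReal (exp_nonneg _)]
  by_cases hp : p ∈ A
  · rw [Set.indicator_of_mem hp, Pi.one_apply]
    exact mul_le_mul_of_nonpos_right (exp_le_exp.2 (sub_le_sub_right (le_of_lt hp) _))
      (sub_nonpos.2 (h01 p).2)
  · rw [Set.indicator_of_notMem hp, sub_zero]
    exact mul_le_mul_of_nonneg_right (exp_le_exp.2 (sub_le_sub_right (not_lt.1 hp) _))
      (h01 p).1

/-- **GDP composition.** If `(P₁, Q₁)` satisfies `μ₁`-GDP and `(P₂, Q₂)`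
satisfies `μ₂`-GDP, then the product measures `(P₁ × P₂, Q₁ × Q₂)` satisfy `μ`-GDP with
`μ = √(μ₁² + μ₂²)`. -/
theorem stmt_15 {Ω₁ Ω₂ : Type*} [MeasurableSpace Ω₁] [MeasurableSpace Ω₂]
    (μ₁ μ₂ : ℝ) (hμ₁ : 0 ≤ μ₁) (hμ₂ : 0 ≤ μ₂)
    (P₁ Q₁ : Measure Ω₁) [IsProbabilityMeasure P₁] [IsProbabilityMeasure Q₁]
    (P₂ Q₂ : Measure Ω₂) [IsProbabilityMeasure P₂] [IsProbabilityMeasure Q₂]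
    (h₁ : ∀ ψ : Ω₁ → ℝ, Measurable ψ → (∀ x, ψ x ∈ Set.Icc (0 : ℝ) 1) →
      (∫ x, ψ x ∂P₁) ∈ Set.Ioo (0 : ℝ) 1 →
      1 - ∫ x, ψ x ∂Q₁ ≥ Phi (PhiInv (1 - ∫ x, ψ x ∂P₁) - μ₁))
    (h₂ : ∀ ψ : Ω₂ → ℝ, Measurable ψ → (∀ x, ψ x ∈ Set.Icc (0 : ℝ) 1) →
      (∫ x, ψ x ∂P₂) ∈ Set.Ioo (0 : ℝ) 1 →
      1 - ∫ x, ψ x ∂Q₂ ≥ Phi (PhiInv (1 - ∫ x, ψ x ∂P₂) - μ₂))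
    (φ : Ω₁ × Ω₂ → ℝ) (hφ : Measurable φ) (hφ01 : ∀ x, φ x ∈ Set.Icc (0 : ℝ) 1)
    (hα : (∫ x, φ x ∂(P₁.prod P₂)) ∈ Set.Ioo (0 : ℝ) 1) :
    1 - ∫ x, φ x ∂(Q₁.prod Q₂) ≥
      Phi (PhiInv (1 - ∫ x, φ x ∂(P₁.prod P₂)) - Real.sqrt (μ₁ ^ 2 + μ₂ ^ 2)) := by
  have hG₁ : IsGDP μ₁ P₁ Q₁ := h₁
  have hG₂ : IsGDP μ₂ P₂ Q₂ := h₂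
  obtain ⟨χ, hχ, hχ01, hχP, hχQ⟩ := hG₁.exists_gaussian_test P₂ Q₂ hφ hφ01
  obtain ⟨ξ, hξ, hξ01, hξP, hξQ⟩ := hG₂.exists_gaussian_test (gaussianReal 0 1)
    (gaussianReal μ₁ 1) (hχ.comp measurable_swap) fun x => hχ01 x.swap
  simp only [Function.comp_apply, integral_prod_swap] at hξP hξQ
  have hsize := hξP.trans hχP
  have hpower := gaussian_prod_test_le (m := μ₂) (n := μ₁) hξ hξ01 (hsize ▸ hα)
  rw [hsize, add_comm (μ₂ ^ 2)] at hpower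
  linarith
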